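/- (Simplicity transfer, from the proof of Lemma 2.7(iii).) Let n ≥ k ≥ 1, A ∈ ℂ^{n×n}, z̃ ∈ ℂ, and let V ∈ ℂ^{n×k} have orthonormal columns (VᴴV = I_k). Set σ := σ_min(A − z̃I) and suppose σ_min(AV − z̃V) = σ. If σ is a simple singular value of A − z̃I, i.e., the eigenspace of the Hermitian matrix (A − z̃I)ᴴ(A − z̃I) for the eigenvalue σ² is one-dimensional, then σ is a simple singular value of AV − z̃V, i.e., the eigenspace of (AV − z̃V)ᴴ(AV − z̃V) for the eigenvalue σ² is one-dimensional. -/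

import Mathlib

noncomputable def enorm2 {ι : Type*} [Fintype ι] (v : ι → ℂ) : ℝ :=
  ‖(WithLp.equiv 2 (ι → ℂ)).symm v‖

noncomputable def sigMin {ι κ : Type*} [Fintype ι] [Fintype κ] (M : Matrix ι κ ℂ) : ℝ :=
  sInf {r : ℝ | ∃ w : κ → ℂ, enorm2 w = 1 ∧ r = enorm2 (M.mulVec w)}

noncomputable def sigV {n : ℕ} (𝒱 : Submodule ℂ (Fin n → ℂ))
    (A : Matrix (Fin n) (Fin n) ℂ) (z : ℂ) : ℝ :=
  sInf {r : ℝ | ∃ v ∈ 𝒱, enorm2 v = 1 ∧ r = enorm2 ((A - z • 1).mulVec v)}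

noncomputable def pspec {n : ℕ} (ε : ℝ) (A : Matrix (Fin n) (Fin n) ℂ) : Set ℂ :=
  {z | sigMin (A - z • 1) ≤ ε}

noncomputable def psa {n : ℕ} (ε : ℝ) (A : Matrix (Fin n) (Fin n) ℂ) : ℝ :=
  sSup (Complex.re '' pspec ε A)

noncomputable def pspecV {n : ℕ} (ε : ℝ) (𝒱 : Submodule ℂ (Fin n → ℂ))
    (A : Matrix (Fin n) (Fin n) ℂ) : Set ℂ :=
  {z | sigV 𝒱 A z ≤ ε}

noncomputable def psaV {n : ℕ} (ε : ℝ) (𝒱 : Submodule ℂ (Fin n → ℂ))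
    (A : Matrix (Fin n) (Fin n) ℂ) : ℝ :=
  sSup (Complex.re '' pspecV ε 𝒱 A)

noncomputable def Amap {n d κ : ℕ} (f : Fin κ → EuclideanSpace ℝ (Fin d) → ℝ)
    (As : Fin κ → Matrix (Fin n) (Fin n) ℂ) (x : EuclideanSpace ℝ (Fin d)) :
    Matrix (Fin n) (Fin n) ℂ :=
  ∑ j, (f j x : ℂ) • As j

noncomputable def opNorm2 {n : ℕ} (Δ : Matrix (Fin n) (Fin n) ℂ) : ℝ :=
  sSup {r : ℝ | ∃ w : Fin n → ℂ, enorm2 w = 1 ∧ r = enorm2 (Δ.mulVec w)}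

theorem enorm2_sq_aux {ι : Type*} [Fintype ι] (v : ι → ℂ) :
    ((enorm2 v : ℂ)) ^ 2 = star v ⬝ᵥ v := by
  have h : enorm2 v ^ 2 = ∑ i, ‖v i‖ ^ 2 := by
    unfold enorm2
    rw [EuclideanSpace.norm_sq_eq]
    rfl
  have h2 : ((enorm2 v : ℂ)) ^ 2 = ((enorm2 v ^ 2 : ℝ) : ℂ) := by push_cast; rfl
  rw [h2, h]
  simp only [dotProduct, Pi.star_apply]
  push_cast
  refine Finset.sum_congr rfl fun i _ => ?_
  exact (Complex.conj_mul' (v i)).symm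

theorem enorm2_smul_aux {ι : Type*} [Fintype ι] (c : ℂ) (v : ι → ℂ) :
    enorm2 (c • v) = ‖c‖ * enorm2 v := by
  unfold enorm2
  rw [← norm_smul]
  rfl

theorem enorm2_nonneg_aux {ι : Type*} [Fintype ι] (v : ι → ℂ) : 0 ≤ enorm2 v := norm_nonneg _

theorem enorm2_eq_zero_aux {ι : Type*} [Fintype ι] (v : ι → ℂ) (h : enorm2 v = 0) : v = 0 := by
  unfold enorm2 at h
  rw [norm_eq_zero] at h
  simpa using h

theorem sigMin_nonneg_aux {ι κ : Type*} [Fintype ι] [Fintype κ] (M : Matrix ι κ ℂ) :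
    0 ≤ sigMin M := by
  apply Real.sInf_nonneg
  rintro r ⟨w, -, rfl⟩
  exact enorm2_nonneg_aux _

theorem sigMin_mul_le_aux {ι κ : Type*} [Fintype ι] [Fintype κ] (M : Matrix ι κ ℂ) (w : κ → ℂ) :
    sigMin M * enorm2 w ≤ enorm2 (M.mulVec w) := by
  by_cases h : enorm2 w = 0
  · rw [h, mul_zero]; exact enorm2_nonneg_aux _
  have hp : 0 < enorm2 w := lt_of_le_of_ne (enorm2_nonneg_aux _) (Ne.symm h)
  have hn : ‖((enorm2 w : ℂ))⁻¹‖ = (enorm2 w)⁻¹ := by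
    rw [norm_inv, Complex.norm_real, Real.norm_of_nonneg hp.le]
  have : sigMin M ≤ (enorm2 w)⁻¹ * enorm2 (M.mulVec w) := by
    apply csInf_le
    · exact ⟨0, by rintro r ⟨w, -, rfl⟩; exact enorm2_nonneg_aux _⟩
    · refine ⟨((enorm2 w : ℂ))⁻¹ • w, ?_, ?_⟩
      · rw [enorm2_smul_aux, hn, inv_mul_cancel₀ h]
      · rw [Matrix.mulVec_smul, enorm2_smul_aux, hn]
  rw [inv_mul_eq_div] at this
  exact (le_div_iff₀ hp).1 this

theorem sigMin_attained_aux {m k : ℕ} (hk : 1 ≤ k) (M : Matrix (Fin m) (Fin k) ℂ) :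
    ∃ w : Fin k → ℂ, enorm2 w = 1 ∧ enorm2 (M.mulVec w) = sigMin M := by
  have hc : IsCompact (Metric.sphere (0 : EuclideanSpace ℂ (Fin k)) 1) := isCompact_sphere _ _
  have hset : {r : ℝ | ∃ w : Fin k → ℂ, enorm2 w = 1 ∧ r = enorm2 (M.mulVec w)} =
      (fun x : EuclideanSpace ℂ (Fin k) => ‖WithLp.toLp 2 (M.mulVec (WithLp.ofLp x))‖) ''
        Metric.sphere 0 1 := by
    ext r
    constructor
    · rintro ⟨w, hw, rfl⟩
      exact ⟨WithLp.toLp 2 w, by simpa [enorm2] using hw, rfl⟩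
    · rintro ⟨x, hx, rfl⟩
      exact ⟨WithLp.ofLp x, by simpa [enorm2] using hx, rfl⟩
  have hcont : Continuous
      (fun x : EuclideanSpace ℂ (Fin k) => ‖WithLp.toLp 2 (M.mulVec (WithLp.ofLp x))‖) := by
    fun_prop
  have hne : (Metric.sphere (0 : EuclideanSpace ℂ (Fin k)) 1).Nonempty :=
    ⟨EuclideanSpace.single ⟨0, hk⟩ 1, by simp⟩
  have hmem := (hc.image hcont).sInf_mem (hne.image _)
  rw [← hset] at hmem
  obtain ⟨w, hw, hr⟩ := hmem
  exact ⟨w, hw, hr.symm⟩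

open scoped Matrix in
theorem quad_aux {ι κ : Type*} [Fintype ι] [Fintype κ] [DecidableEq κ] (M : Matrix ι κ ℂ) (σ : ℝ)
    (w : κ → ℂ) : star w ⬝ᵥ ((Mᴴ * M - ((σ : ℂ) ^ 2) • 1).mulVec w) =
      ((enorm2 (M.mulVec w) ^ 2 - σ ^ 2 * enorm2 w ^ 2 : ℝ) : ℂ) := by
  push_cast
  rw [enorm2_sq_aux, enorm2_sq_aux, Matrix.sub_mulVec, dotProduct_sub, Matrix.smul_mulVec,
    Matrix.one_mulVec, dotProduct_smul, smul_eq_mul, ← Matrix.mulVec_mulVec,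
    Matrix.dotProduct_mulVec, Matrix.star_mulVec]

open scoped Matrix ComplexOrder in
theorem psd_aux {ι κ : Type*} [Fintype ι] [Fintype κ] [DecidableEq κ] (M : Matrix ι κ ℂ) (σ : ℝ)
    (hσ : σ = sigMin M) : (Mᴴ * M - ((σ : ℂ) ^ 2) • 1).PosSemidef := by
  apply Matrix.PosSemidef.of_dotProduct_mulVec_nonneg
  · simp [Matrix.IsHermitian, Matrix.conjTranspose_sub, Matrix.conjTranspose_mul,
      Matrix.conjTranspose_smul]
  · intro w
    rw [quad_aux, Complex.zero_le_real, sub_nonneg, ← mul_pow]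
    apply pow_le_pow_left₀
    · exact mul_nonneg (hσ ▸ sigMin_nonneg_aux M) (enorm2_nonneg_aux _)
    · rw [hσ]; exact sigMin_mul_le_aux M w

open scoped Matrix in
theorem stmt11 {n k : ℕ} (hk : 1 ≤ k) (hkn : k ≤ n)
    (A : Matrix (Fin n) (Fin n) ℂ) (z : ℂ)
    (V : Matrix (Fin n) (Fin k) ℂ) (hV : Vᴴ * V = 1)
    (σ : ℝ) (hσ : σ = sigMin (A - z • 1))
    (hred : sigMin (A * V - z • V) = σ)
    (hsimple : Module.finrank ℂ
      ↥(LinearMap.ker ((((A - z • 1)ᴴ * (A - z • 1)) - ((σ : ℂ) ^ 2) • 1).mulVecLin)) = 1) :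
    Module.finrank ℂ
      ↥(LinearMap.ker ((((A * V - z • V)ᴴ * (A * V - z • V)) - ((σ : ℂ) ^ 2) • 1).mulVecLin)) = 1 := by
  have hM : A * V - z • V = (A - z • 1) * V := by
    rw [Matrix.sub_mul, Matrix.smul_mul, Matrix.one_mul]
  have hiff : ∀ w : Fin k → ℂ, enorm2 (V.mulVec w) ^ 2 = enorm2 w ^ 2 := by
    intro w
    have h : ((enorm2 (V.mulVec w) : ℂ)) ^ 2 = (enorm2 w : ℂ) ^ 2 := by
      rw [enorm2_sq_aux, enorm2_sq_aux, Matrix.star_mulVec, ← Matrix.dotProduct_mulVec,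
        Matrix.mulVec_mulVec, hV, Matrix.one_mulVec]
    exact_mod_cast h
  have hH := psd_aux _ σ hσ
  have hK := psd_aux _ σ hred.symm
  have hinj : Function.Injective V.mulVecLin := by
    intro a b hab
    have := congrArg (Vᴴ.mulVec) hab
    simpa [Matrix.mulVec_mulVec, hV] using this
  -- the kernel embeds
  have hle : ∀ w ∈ LinearMap.ker
      ((((A * V - z • V)ᴴ * (A * V - z • V)) - ((σ : ℂ) ^ 2) • 1).mulVecLin),
      V.mulVecLin w ∈ LinearMap.ker
        ((((A - z • 1)ᴴ * (A - z • 1)) - ((σ : ℂ) ^ 2) • 1).mulVecLin) := by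
    intro w hw
    rw [LinearMap.mem_ker, Matrix.mulVecLin_apply] at hw ⊢
    rw [← hK.dotProduct_mulVec_zero_iff, quad_aux] at hw
    rw [← hH.dotProduct_mulVec_zero_iff, quad_aux]
    rw [Matrix.mulVecLin_apply, hiff, Matrix.mulVec_mulVec, ← hM]
    exact hw
  apply le_antisymm
  · rw [← hsimple]
    refine LinearMap.finrank_le_finrank_of_injective (f := V.mulVecLin.restrict hle) ?_
    intro a b hab
    exact Subtype.ext (hinj (congrArg Subtype.val hab))
  · obtain ⟨w, hw1, hw2⟩ := sigMin_attained_aux hk (A * V - z • V)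
    have hmem : w ∈ LinearMap.ker
        ((((A * V - z • V)ᴴ * (A * V - z • V)) - ((σ : ℂ) ^ 2) • 1).mulVecLin) := by
      rw [LinearMap.mem_ker, Matrix.mulVecLin_apply, ← hK.dotProduct_mulVec_zero_iff, quad_aux,
        hw1, hw2, hred]
      simp
    have hw0 : w ≠ 0 := by
      rintro rfl
      simp [enorm2] at hw1
    rw [Nat.succ_le_iff, Module.finrank_pos_iff_exists_ne_zero]
    exact ⟨⟨w, hmem⟩, fun h => hw0 (congrArg Subtype.val h)⟩
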